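/- (Liouville involutivity for the Ruijsenaars–Schneider model.) For all integers k, m ≥ 1 and generic spectral parameters z, w, the traces of powers of the Ruijsenaars–Schneider Lax matrix Poisson-commute: {tr(L(z)^k), tr(L(w)^m)} = 0. -/

import Mathlib

open Complex Matrix Kronecker Finset Filter Topology

noncomputable section

/-- The lattice Λ = ℤ + τℤ. -/
def Lam (τ : ℂ) : Set ℂ := {z : ℂ | ∃ m n : ℤ, z = (m : ℂ) + (n : ℂ) * τ}

/-- The first Jacobi theta function
ϑ(z) = −∑_{j∈ℤ} exp(πi(j+1/2)²τ + 2πi(j+1/2)(z+1/2)). -/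
def theta (τ : ℂ) (z : ℂ) : ℂ :=
  -∑' j : ℤ, Complex.exp ((Real.pi : ℂ) * Complex.I * ((j : ℂ) + 1 / 2) ^ 2 * τ +
      2 * (Real.pi : ℂ) * Complex.I * ((j : ℂ) + 1 / 2) * (z + 1 / 2))

/-- The first Eisenstein function E₁(u) = ϑ′(u)/ϑ(u). -/
def E1 (τ : ℂ) (u : ℂ) : ℂ := deriv (theta τ) u / theta τ u

/-- The Kronecker function φ(z,u) = ϑ′(0)·ϑ(z+u)/(ϑ(z)·ϑ(u)). -/
def phi (τ : ℂ) (z u : ℂ) : ℂ :=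
  deriv (theta τ) 0 * theta τ (z + u) / (theta τ z * theta τ u)

/-- The second Eisenstein function E₂(u) = −E₁′(u). -/
def E2 (τ : ℂ) (u : ℂ) : ℂ := -deriv (E1 τ) u

/-- The Weierstrass ℘-function: ℘(u) = E₂(u) + (1/3)·ϑ‴(0)/ϑ′(0). -/
def wp (τ : ℂ) (u : ℂ) : ℂ :=
  E2 τ u + (1 / 3) * iteratedDeriv 3 (theta τ) 0 / deriv (theta τ) 0

/-- Phase space ℂ^{2N} with coordinates (p, q). -/
abbrev Phase (N : ℕ) := (Fin N → ℂ) × (Fin N → ℂ)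

/-- Canonical Poisson bracket
{f,g}(x) = ∑ᵢ (∂f/∂pᵢ·∂g/∂qᵢ − ∂f/∂qᵢ·∂g/∂pᵢ)(x). -/
def pbracket {N : ℕ} (f g : Phase N → ℂ) (x : Phase N) : ℂ :=
  ∑ i : Fin N,
    (deriv (fun t => f (Function.update x.1 i t, x.2)) (x.1 i) *
        deriv (fun t => g (x.1, Function.update x.2 i t)) (x.2 i) -
      deriv (fun t => f (x.1, Function.update x.2 i t)) (x.2 i) *
        deriv (fun t => g (Function.update x.1 i t, x.2)) (x.1 i))

/-- b_j = e^{p_j/c}·∏_{k≠j} ϑ(q_j−q_k−η)/ϑ(q_j−q_k). -/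
def bfun (τ η c : ℂ) {N : ℕ} (j : Fin N) (x : Phase N) : ℂ :=
  Complex.exp (x.1 j / c) *
    ∏ k ∈ Finset.univ.filter (fun k => k ≠ j),
      theta τ (x.2 j - x.2 k - η) / theta τ (x.2 j - x.2 k)

/-- The Ruijsenaars–Schneider Lax matrix L_{ij}(z) = φ(z, q_i−q_j+η)·b_j,
as a matrix-valued function on phase space. -/
def Lax (τ η c : ℂ) {N : ℕ} (z : ℂ) (y : Phase N) : Matrix (Fin N) (Fin N) ℂ :=
  Matrix.of fun i j => phi τ z (y.2 i - y.2 j + η) * bfun τ η c j y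

/-! ### Theta function basics -/

lemma theta_eq_J (τ z : ℂ) : theta τ z =
    -(cexp (Real.pi * I * τ / 4 + Real.pi * I * (z + 1 / 2)) *
      jacobiTheta₂ (z + 1 / 2 + τ / 2) τ) := by
  unfold theta jacobiTheta₂ jacobiTheta₂_term
  rw [← tsum_mul_left]
  congr 2
  ext j
  rw [← Complex.exp_add]
  congr 1
  ring

lemma theta_differentiable {τ : ℂ} (hτ : 0 < τ.im) : Differentiable ℂ (theta τ) := by
  have : theta τ = fun z => -(cexp (Real.pi * I * τ / 4 + Real.pi * I * (z + 1 / 2)) *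
      jacobiTheta₂ (z + 1 / 2 + τ / 2) τ) := by
    ext z; exact theta_eq_J τ z
  rw [this]
  intro z
  have h := differentiableAt_jacobiTheta₂_fst (z + 1 / 2 + τ / 2) hτ
  have h2 : DifferentiableAt ℂ (fun z : ℂ => jacobiTheta₂ (z + 1 / 2 + τ / 2) τ) z :=
    DifferentiableAt.comp (g := fun v => jacobiTheta₂ v τ)
      (f := fun z : ℂ => z + 1 / 2 + τ / 2) z h (by fun_prop)
  fun_prop

lemma theta_add_one (τ z : ℂ) : theta τ (z + 1) = -theta τ z := by
  rw [theta_eq_J, theta_eq_J,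
    show z + 1 + 1 / 2 + τ / 2 = (z + 1 / 2 + τ / 2) + 1 by ring, jacobiTheta₂_add_left,
    show Real.pi * I * τ / 4 + Real.pi * I * (z + 1 + 1 / 2) =
      (Real.pi * I * τ / 4 + Real.pi * I * (z + 1 / 2)) + Real.pi * I by ring,
    Complex.exp_add, Complex.exp_pi_mul_I]
  ring

lemma theta_add_tau (τ z : ℂ) :
    theta τ (z + τ) = -cexp (-(Real.pi * I * τ) - 2 * Real.pi * I * z) * theta τ z := by
  rw [theta_eq_J, theta_eq_J,
    show z + τ + 1 / 2 + τ / 2 = (z + 1 / 2 + τ / 2) + τ by ring, jacobiTheta₂_add_left']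
  have h : cexp (Real.pi * I * τ / 4 + Real.pi * I * (z + τ + 1 / 2)) *
      cexp (-Real.pi * I * (τ + 2 * (z + 1 / 2 + τ / 2))) =
      -cexp (-(Real.pi * I * τ) - 2 * Real.pi * I * z) *
        cexp (Real.pi * I * τ / 4 + Real.pi * I * (z + 1 / 2)) := by
    rw [← Complex.exp_add, neg_mul (cexp _), ← Complex.exp_add,
      show Real.pi * I * τ / 4 + Real.pi * I * (z + τ + 1 / 2) +
        (-Real.pi * I * (τ + 2 * (z + 1 / 2 + τ / 2))) =
        (-(Real.pi * I * τ) - 2 * Real.pi * I * z +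
        (Real.pi * I * τ / 4 + Real.pi * I * (z + 1 / 2))) - Real.pi * I by ring,
      Complex.exp_sub, Complex.exp_pi_mul_I]
    ring
  rw [← mul_assoc, h]
  ring

lemma theta_neg (τ z : ℂ) : theta τ (-z) = -theta τ z := by
  unfold theta
  rw [← (Equiv.subLeft (-1 : ℤ)).tsum_eq, ← tsum_neg, ← tsum_neg, ← tsum_neg]
  refine tsum_congr fun j => ?_
  rw [neg_neg]
  rw [Equiv.subLeft_apply, ← Complex.exp_add_pi_mul_I, ← Complex.exp_periodic.int_mul j]
  congr 1
  push_cast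
  ring

/-! ### Product formula -/

def thT (τ : ℂ) (j : ℤ) (z : ℂ) : ℂ :=
  Complex.exp ((Real.pi : ℂ) * Complex.I * ((j : ℂ) + 1 / 2) ^ 2 * τ +
      2 * (Real.pi : ℂ) * Complex.I * ((j : ℂ) + 1 / 2) * (z + 1 / 2))

lemma thT_summable {τ : ℂ} (hτ : 0 < τ.im) (z : ℂ) : Summable (fun j => thT τ j z) := by
  have h := ((summable_jacobiTheta₂_term_iff (z + 1 / 2 + τ / 2) τ).2 hτ).mul_left
    (cexp (Real.pi * I * τ / 4 + Real.pi * I * (z + 1 / 2)))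
  refine h.congr fun j => ?_
  rw [jacobiTheta₂_term, thT, ← Complex.exp_add]
  congr 1
  ring

def aT (τ : ℂ) (n : ℤ) (x : ℂ) : ℂ :=
  cexp (2 * Real.pi * I * τ * n ^ 2 + 4 * Real.pi * I * n * x)

def bT (τ : ℂ) (n : ℤ) (x : ℂ) : ℂ :=
  cexp (Real.pi * I * τ * (2 * n + 1) ^ 2 / 2 + 2 * Real.pi * I * (2 * n + 1) * x)

lemma aT_summable {τ : ℂ} (hτ : 0 < τ.im) (z : ℂ) : Summable (fun j => aT τ j z) := by
  have h := ((summable_jacobiTheta₂_term_iff (2 * z) (2 * τ)).2 (by simpa using hτ))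
  refine h.congr fun j => ?_
  rw [jacobiTheta₂_term, aT]
  congr 1
  ring

lemma bT_summable {τ : ℂ} (hτ : 0 < τ.im) (z : ℂ) : Summable (fun j => bT τ j z) := by
  have h := ((summable_jacobiTheta₂_term_iff (2 * z + τ) (2 * τ)).2 (by simpa using hτ)).mul_left
    (cexp (Real.pi * I * τ / 2 + 2 * Real.pi * I * z))
  refine h.congr fun j => ?_
  rw [jacobiTheta₂_term, bT, ← Complex.exp_add]
  congr 1
  ring

def parEquiv : (ℤ × ℤ) ⊕ (ℤ × ℤ) ≃ ℤ × ℤ :=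
  Equiv.ofBijective
    (Sum.elim (fun p => (p.1 + p.2, p.1 - p.2)) (fun p => (p.1 + p.2, p.1 - p.2 - 1))) (by
    constructor
    · rintro (⟨a, b⟩ | ⟨a, b⟩) (⟨c, d⟩ | ⟨c, d⟩) h <;>
        simp only [Sum.elim_inl, Sum.elim_inr, Prod.mk.injEq] at h
      · congr 2 <;> omega
      · omega
      · omega
      · congr 2 <;> omega
    · rintro ⟨j, k⟩
      rcases Int.even_or_odd' (j + k) with ⟨a, h | h⟩
      · exact ⟨Sum.inl (a, j - a), by simp only [Sum.elim_inl, Prod.mk.injEq]; omega⟩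
      · exact ⟨Sum.inr (a + 1, j - a - 1), by
          simp only [Sum.elim_inr, Prod.mk.injEq]; omega⟩)

lemma parEquiv_inl (a b : ℤ) : parEquiv (Sum.inl (a, b)) = (a + b, a - b) := rfl

lemma parEquiv_inr (a b : ℤ) : parEquiv (Sum.inr (a, b)) = (a + b, a - b - 1) := rfl

lemma theta_prod {τ : ℂ} (hτ : 0 < τ.im) (x y : ℂ) :
    theta τ (x + y) * theta τ (x - y) =
      (∑' n, aT τ n x) * (∑' n, bT τ n y) - (∑' n, bT τ n x) * (∑' n, aT τ n y) := by
  have e1 : theta τ (x + y) * theta τ (x - y) =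
      ∑' p : ℤ × ℤ, thT τ p.1 (x + y) * thT τ p.2 (x - y) := by
    rw [← tsum_mul_tsum_of_summable_norm (thT_summable hτ _).norm (thT_summable hτ _).norm]
    simp only [theta, thT, neg_mul_neg]
  have hab := summable_mul_of_summable_norm (aT_summable hτ x).norm (bT_summable hτ y).norm
  have hba := summable_mul_of_summable_norm (bT_summable hτ x).norm (aT_summable hτ y).norm
  have s1 := hab.hasSum
  have s2 := hba.hasSum.neg
  rw [← tsum_mul_tsum_of_summable_norm (aT_summable hτ x).norm (bT_summable hτ y).norm] at s1
  rw [← tsum_mul_tsum_of_summable_norm (bT_summable hτ x).norm (aT_summable hτ y).norm] at s2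
  have key : HasSum ((fun p : ℤ × ℤ => thT τ p.1 (x + y) * thT τ p.2 (x - y)) ∘ parEquiv)
      (-((∑' n, bT τ n x) * (∑' n, aT τ n y)) + (∑' n, aT τ n x) * (∑' n, bT τ n y)) := by
    refine HasSum.sum ?_ ?_
    · refine Eq.mp (congrArg (fun f => HasSum f _) (funext fun p => Eq.symm ?_)) s2
      obtain ⟨a, b⟩ := p
      simp only [Function.comp_apply, parEquiv_inl, thT, aT, bT]
      rw [← Complex.exp_add, ← Complex.exp_add, ← Complex.exp_add_pi_mul_I,
        ← Complex.exp_periodic.int_mul (-a)]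
      congr 1
      push_cast
      ring
    · refine Eq.mp (congrArg (fun f => HasSum f _) (funext fun p => Eq.symm ?_)) s1
      obtain ⟨a, b⟩ := p
      simp only [Function.comp_apply, parEquiv_inr, thT, aT, bT]
      rw [← Complex.exp_add, ← Complex.exp_add, ← Complex.exp_periodic.int_mul (-a)]
      congr 1
      push_cast
      ring
  rw [e1, ((Equiv.hasSum_iff parEquiv).1 key).tsum_eq]
  ring

lemma theta_three {τ : ℂ} (hτ : 0 < τ.im) (x y u v : ℂ) :
    theta τ (x + y) * theta τ (x - y) * (theta τ (u + v) * theta τ (u - v))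
      - theta τ (x + u) * theta τ (x - u) * (theta τ (y + v) * theta τ (y - v))
      + theta τ (x + v) * theta τ (x - v) * (theta τ (y + u) * theta τ (y - u)) = 0 := by
  simp only [theta_prod hτ]
  ring

/-! ### Addition formula for E1 -/

lemma theta_four {τ : ℂ} (hτ : 0 < τ.im) (a b c e : ℂ) :
    theta τ (a + e) * theta τ (b + e) * theta τ (c + e) * theta τ (a + b + c - e)
      - theta τ (a - e) * theta τ (b - e) * theta τ (c - e) * theta τ (a + b + c + e)
      = theta τ (a + b) * theta τ (b + c) * theta τ (c + a) * theta τ (2 * e) := by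
  have h := theta_three hτ ((a + b + c + a) / 2) ((b + c) / 2 - e) ((b + c) / 2 + e) ((b - c) / 2)
  rw [show (a + b + c + a) / 2 + ((b + c) / 2 - e) = a + b + c - e by ring,
    show (a + b + c + a) / 2 - ((b + c) / 2 - e) = a + e by ring,
    show (b + c) / 2 + e + (b - c) / 2 = b + e by ring,
    show (b + c) / 2 + e - (b - c) / 2 = c + e by ring,
    show (a + b + c + a) / 2 + ((b + c) / 2 + e) = a + b + c + e by ring,
    show (a + b + c + a) / 2 - ((b + c) / 2 + e) = a - e by ring,
    show (b + c) / 2 - e + (b - c) / 2 = b - e by ring,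
    show (b + c) / 2 - e - (b - c) / 2 = c - e by ring,
    show (a + b + c + a) / 2 + (b - c) / 2 = a + b by ring,
    show (a + b + c + a) / 2 - (b - c) / 2 = c + a by ring,
    show (b + c) / 2 - e + ((b + c) / 2 + e) = b + c by ring,
    show (b + c) / 2 - e - ((b + c) / 2 + e) = -(2 * e) by ring, theta_neg] at h
  linear_combination h

lemma theta_shift {τ : ℂ} (hτ : 0 < τ.im) (a s : ℂ) :
    HasDerivAt (fun e => theta τ (a + s * e)) (deriv (theta τ) a * s) 0 := by
  have h1 : HasDerivAt (fun e : ℂ => a + s * e) s 0 := by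
    simpa using ((hasDerivAt_id (0 : ℂ)).const_mul s).const_add a
  have h2 : HasDerivAt (theta τ) (deriv (theta τ) a) (a + s * 0) := by
    rw [mul_zero, add_zero]; exact (theta_differentiable hτ a).hasDerivAt
  exact HasDerivAt.comp (h₂ := theta τ) (h := fun e => a + s * e) (0 : ℂ) h2 h1

lemma theta_zero (τ : ℂ) : theta τ 0 = 0 := by
  have h := theta_neg τ 0
  rw [neg_zero] at h
  linear_combination h / 2

lemma theta_deriv_add {τ : ℂ} (hτ : 0 < τ.im) (a b c : ℂ) :
    deriv (theta τ) a * theta τ b * theta τ c * theta τ (a + b + c)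
    + theta τ a * deriv (theta τ) b * theta τ c * theta τ (a + b + c)
    + theta τ a * theta τ b * deriv (theta τ) c * theta τ (a + b + c)
    - theta τ a * theta τ b * theta τ c * deriv (theta τ) (a + b + c)
    = deriv (theta τ) 0 * (theta τ (a + b) * theta τ (b + c) * theta τ (c + a)) := by
  have hL := ((((theta_shift hτ a 1).mul (theta_shift hτ b 1)).mul (theta_shift hτ c 1)).mul
      (theta_shift hτ (a + b + c) (-1))).sub
    ((((theta_shift hτ a (-1)).mul (theta_shift hτ b (-1))).mul (theta_shift hτ c (-1))).mul
      (theta_shift hτ (a + b + c) 1))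
  have hR := (theta_shift hτ 0 2).const_mul (theta τ (a + b) * theta τ (b + c) * theta τ (c + a))
  have := hL.unique (hR.congr_of_eventuallyEq (Filter.Eventually.of_forall fun e => by
    have := theta_four hτ a b c e
    simp only [Pi.mul_apply, Pi.sub_apply, one_mul, neg_one_mul, ← sub_eq_add_neg, zero_add]
    exact this))
  simp only [Pi.mul_apply, mul_zero, add_zero] at this
  linear_combination this / 2

lemma E1_add {τ : ℂ} (hτ : 0 < τ.im) (a b c d : ℂ) (hd : d = a + b + c) (ha : theta τ a ≠ 0)
    (hb : theta τ b ≠ 0) (hc : theta τ c ≠ 0) (hd0 : theta τ d ≠ 0) :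
    E1 τ a + E1 τ b + E1 τ c - E1 τ d =
      deriv (theta τ) 0 * (theta τ (a + b) * theta τ (b + c) * theta τ (c + a)) /
        (theta τ a * theta τ b * theta τ c * theta τ d) := by
  rw [← theta_deriv_add hτ, ← hd]
  unfold E1
  field_simp

lemma theta_deriv_neg {τ : ℂ} (hτ : 0 < τ.im) (z : ℂ) :
    deriv (theta τ) (-z) = deriv (theta τ) z := by
  have h : HasDerivAt (fun z => theta τ (-z)) (-deriv (theta τ) (-z)) z := by
    have h2 := (theta_differentiable hτ (-z)).hasDerivAt
    have h3 := HasDerivAt.comp (h₂ := theta τ) (h := fun z => -z) z h2 (hasDerivAt_neg z)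
    rw [mul_neg_one] at h3
    exact h3
  have h' : HasDerivAt (fun z => theta τ (-z)) (-deriv (theta τ) z) z := by
    simp only [theta_neg]
    exact (theta_differentiable hτ z).hasDerivAt.neg
  exact neg_injective (h.unique h')

lemma E1_neg {τ : ℂ} (hτ : 0 < τ.im) (z : ℂ) : E1 τ (-z) = -E1 τ z := by
  rw [E1, E1, theta_neg, theta_deriv_neg hτ, div_neg]

/-! ### Zeros of theta -/

lemma theta_zero_rel {τ : ℂ} (hτ : 0 < τ.im) {e : ℂ} (he : theta τ e = 0) (a b d : ℂ) :
    theta τ (b + (d + e)) * theta τ (b - (d + e)) * (theta τ (a + d) * theta τ (a - d)) =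
    theta τ (b + d) * theta τ (b - d) * (theta τ (a + (d + e)) * theta τ (a - (d + e))) := by
  have h := theta_three hτ b (d + e) a d
  rw [show d + e - d = e by ring, he, show d + e - a = -(a - (d + e)) by ring, theta_neg,
    add_comm (d + e) a] at h
  linear_combination h

lemma theta_exists_ne {τ : ℂ} (hτ : 0 < τ.im) (h0 : ∃ z, theta τ z ≠ 0) (s t : ℂ) :
    ∃ a, theta τ (a + s) ≠ 0 ∧ theta τ (a + t) ≠ 0 := by
  by_contra! hcon
  have han : ∀ s : ℂ, AnalyticOnNhd ℂ (fun a => theta τ (a + s)) Set.univ := fun s =>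
    ((theta_differentiable hτ).comp (by fun_prop : Differentiable ℂ fun a : ℂ => a + s)
      ).differentiableOn.analyticOnNhd isOpen_univ
  obtain ⟨z, hz⟩ := h0
  rcases AnalyticOnNhd.eq_zero_or_eq_zero_of_mul_eq_zero (han s) (han t)
    (fun a _ => by
      by_cases h : theta τ (a + s) = 0
      · simp [h]
      · simp [hcon a h]) isPreconnected_univ with h | h
  · exact hz (by simpa using h (z - s) (Set.mem_univ _))
  · exact hz (by simpa using h (z - t) (Set.mem_univ _))

lemma theta_K {τ : ℂ} (hτ : 0 < τ.im) (h0 : ∃ z, theta τ z ≠ 0) {e : ℂ} (he : theta τ e = 0) :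
    ∃ K : ℂ → ℂ, Differentiable ℂ K ∧ ∀ u v,
      theta τ (u + e) * theta τ (v - e) = K (u - v) * (theta τ u * theta τ v) := by
  have hth := theta_differentiable hτ
  choose α h1 h2 using fun D : ℂ => theta_exists_ne hτ h0 (D / 2) (-(D / 2))
  simp only [← sub_eq_add_neg] at h2
  have h12 : ∀ D, theta τ (α D + D / 2) * theta τ (α D - D / 2) ≠ 0 :=
    fun D => mul_ne_zero (h1 D) (h2 D)
  refine ⟨fun D => theta τ (α D + (D / 2 + e)) * theta τ (α D - (D / 2 + e)) /
    (theta τ (α D + D / 2) * theta τ (α D - D / 2)), ?_, ?_⟩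
  · intro D₀
    have hev : ∀ᶠ D in 𝓝 D₀, theta τ (α D₀ + D / 2) * theta τ (α D₀ - D / 2) ≠ 0 := by
      have hc : Continuous fun D => theta τ (α D₀ + D / 2) * theta τ (α D₀ - D / 2) := by
        have := hth.continuous
        fun_prop
      exact hc.continuousAt.eventually_ne (h12 D₀)
    have hd : DifferentiableAt ℂ (fun D => theta τ (α D₀ + (D / 2 + e)) *
        theta τ (α D₀ - (D / 2 + e)) / (theta τ (α D₀ + D / 2) * theta τ (α D₀ - D / 2))) D₀ := by
      refine DifferentiableAt.div ?_ ?_ (h12 D₀) <;> fun_prop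
    refine hd.congr_of_eventuallyEq ?_
    filter_upwards [hev] with D hD
    rw [div_eq_div_iff (h12 D) hD]
    rw [theta_zero_rel hτ he]
    ring
  · intro u v
    have := theta_zero_rel hτ he (α (u - v)) ((u + v) / 2) ((u - v) / 2)
    rw [show (u + v) / 2 + ((u - v) / 2 + e) = u + e by ring,
      show (u + v) / 2 - ((u - v) / 2 + e) = v - e by ring,
      show (u + v) / 2 + (u - v) / 2 = u by ring,
      show (u + v) / 2 - (u - v) / 2 = v by ring] at this
    have h3 := h12 (u - v)
    rw [div_mul_eq_mul_div, eq_div_iff h3, this]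
    ring

lemma bounded_of_periodic {τ : ℂ} (hτ : 0 < τ.im) (f : ℂ → ℝ) (hf : Continuous f)
    (h1 : Function.Periodic f 1) (h2 : Function.Periodic f τ) : ∃ C, ∀ z, f z ≤ C := by
  have hK : IsCompact ((fun p : ℝ × ℝ => f (p.1 + p.2 * τ)) '' (Set.Icc 0 1 ×ˢ Set.Icc 0 1)) := by
    refine (isCompact_Icc.prod isCompact_Icc).image ?_
    fun_prop
  obtain ⟨C, hC⟩ := hK.bddAbove
  refine ⟨C, fun z => ?_⟩
  set t : ℝ := z.im / τ.im
  set s : ℝ := z.re - t * τ.re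
  have hz : z = s + t * τ := by
    apply Complex.ext
    · simp [s]
    · simp [t, hτ.ne']
  have : f z = f ((Int.fract s : ℝ) + (Int.fract t : ℝ) * τ) := by
    rw [← h1.sub_zsmul_eq ⌊s⌋, ← h2.sub_zsmul_eq ⌊t⌋]
    congr 1
    conv_lhs => rw [hz]
    simp only [Int.fract, zsmul_eq_mul]
    push_cast
    ring
  rw [this]
  exact hC ⟨(Int.fract s, Int.fract t), ⟨⟨Int.fract_nonneg _, (Int.fract_lt_one _).le⟩,
    ⟨Int.fract_nonneg _, (Int.fract_lt_one _).le⟩⟩, rfl⟩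

lemma theta_ne_zero {τ : ℂ} (hτ : 0 < τ.im) (h0 : ∃ z, theta τ z ≠ 0) {e : ℂ}
    (he : e ∉ Lam τ) : theta τ e ≠ 0 := by
  intro hθ
  apply he
  obtain ⟨K, hKd, hK⟩ := theta_K hτ h0 hθ
  have hK1 : ∀ D, K (D + 1) = K D := by
    intro D
    obtain ⟨a, ha, hb⟩ := theta_exists_ne hτ h0 D 0
    rw [add_zero] at hb
    have k1 := hK (a + D) a
    have k2 := hK (a + D + 1) a
    rw [show a + D + 1 + e = a + D + e + 1 by ring, theta_add_one, theta_add_one,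
      show a + D + 1 - a = D + 1 by ring] at k2
    rw [show a + D - a = D by ring] at k1
    have : (K (D + 1) - K D) * (theta τ (a + D) * theta τ a) = 0 := by
      linear_combination k1 + k2
    rcases mul_eq_zero.1 this with h | h
    · exact sub_eq_zero.1 h
    · exact absurd h (mul_ne_zero ha hb)
  have hKτ : ∀ D, K (D + τ) = cexp (-(2 * Real.pi * I * e)) * K D := by
    intro D
    obtain ⟨a, ha, hb⟩ := theta_exists_ne hτ h0 D 0
    rw [add_zero] at hb
    have k1 := hK (a + D) a
    have k2 := hK (a + D + τ) a
    rw [show a + D + τ + e = a + D + e + τ by ring, theta_add_tau, theta_add_tau,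
      show a + D + τ - a = D + τ by ring,
      show -(Real.pi * I * τ) - 2 * Real.pi * I * (a + D + e) =
        (-(Real.pi * I * τ) - 2 * Real.pi * I * (a + D)) + (-(2 * Real.pi * I * e)) by ring,
      Complex.exp_add] at k2
    rw [show a + D - a = D by ring] at k1
    have hx := Complex.exp_ne_zero (-(Real.pi * I * τ) - 2 * Real.pi * I * (a + D))
    have : (K (D + τ) - cexp (-(2 * Real.pi * I * e)) * K D) *
        (cexp (-(Real.pi * I * τ) - 2 * Real.pi * I * (a + D)) *
          (theta τ (a + D) * theta τ a)) = 0 := by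
      linear_combination k2 + cexp (-(Real.pi * I * τ) - 2 * Real.pi * I * (a + D)) *
        cexp (-(2 * Real.pi * I * e)) * k1
    rcases mul_eq_zero.1 this with h | h
    · exact sub_eq_zero.1 h
    · exact absurd h (mul_ne_zero hx (mul_ne_zero ha hb))
  set β : ℝ := e.im / τ.im
  set α : ℝ := e.re - β * τ.re
  have hz : e = α + β * τ := by
    apply Complex.ext
    · simp [α]
    · simp [β, hτ.ne']
  set M : ℂ → ℂ := fun D => K D * cexp (2 * Real.pi * I * β * D)
  have hMd : Differentiable ℂ M := by fun_prop
  have hM1 : ∀ D, M (D + 1) = cexp (2 * Real.pi * I * β) * M D := by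
    intro D
    simp only [M]
    rw [hK1, mul_add, Complex.exp_add, mul_one]
    ring
  have hMτ : ∀ D, M (D + τ) = cexp (2 * Real.pi * I * (-α : ℝ)) * M D := by
    intro D
    simp only [M]
    rw [hKτ, mul_add, Complex.exp_add]
    have : cexp (-(2 * Real.pi * I * e)) * cexp (2 * Real.pi * I * β * τ) =
        cexp (2 * Real.pi * I * (-α : ℝ)) := by
      rw [← Complex.exp_add]
      congr 1
      conv_lhs => rw [hz]
      push_cast
      ring
    rw [← this]
    ring
  have hnorm : ∀ r : ℝ, ‖cexp (2 * Real.pi * I * r)‖ = 1 := by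
    intro r
    rw [show 2 * Real.pi * I * r = ((2 * Real.pi * r : ℝ) : ℂ) * I by push_cast; ring]
    exact Complex.norm_exp_ofReal_mul_I _
  obtain ⟨C, hC⟩ := bounded_of_periodic hτ (fun D => ‖M D‖) hMd.continuous.norm
    (fun D => by simp only [hM1, norm_mul, hnorm, one_mul])
    (fun D => by simp only [hMτ, norm_mul, hnorm, one_mul])
  have hconst : ∀ x y, M x = M y := fun x y =>
    hMd.apply_eq_apply_of_bounded (isBounded_iff_forall_norm_le.2
      ⟨C, by rintro _ ⟨x, rfl⟩; exact hC x⟩) x y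
  have hM0 : M 0 ≠ 0 := by
    intro hM0
    obtain ⟨u, hu, hv⟩ := theta_exists_ne hτ h0 e (-e)
    have := hK u u
    have hMu : M (u - u) = 0 := by rw [hconst _ 0, hM0]
    have : K (u - u) = 0 := by
      rcases mul_eq_zero.1 hMu with h | h
      · exact h
      · exact absurd h (Complex.exp_ne_zero _)
    have := hK u u
    rw [‹K (u - u) = 0›, zero_mul] at this
    rw [← sub_eq_add_neg] at hv
    exact mul_ne_zero hu hv this
  have hint : ∀ r : ℝ, cexp (2 * Real.pi * I * r) * M 0 = M 0 → ∃ n : ℤ, r = n := by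
    intro r h
    have h1 : cexp (2 * Real.pi * I * r) = 1 := mul_right_cancel₀ hM0 (by rw [h, one_mul])
    obtain ⟨n, hn⟩ := Complex.exp_eq_one_iff.1 h1
    refine ⟨n, ?_⟩
    have : (r : ℂ) = (n : ℂ) := mul_left_cancel₀ Complex.two_pi_I_ne_zero (by rw [hn]; ring)
    exact_mod_cast this
  obtain ⟨n, hn⟩ := hint β (by rw [← hM1]; exact hconst _ _)
  obtain ⟨m, hm⟩ := hint (-α) (by rw [← hMτ]; exact hconst _ _)
  refine ⟨-m, n, ?_⟩
  rw [hz, hn, show α = -(m : ℝ) by linarith]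
  push_cast
  ring

/-! ### Kronecker function identities -/

lemma phi_I {τ : ℂ} (hτ : 0 < τ.im) (z w s t x y : ℂ) (hst : s + t = x + y)
    (hz : theta τ z ≠ 0) (hw : theta τ w ≠ 0) (hzw : theta τ (z - w) ≠ 0)
    (hs : theta τ s ≠ 0) (ht : theta τ t ≠ 0) (hx : theta τ x ≠ 0) (hy : theta τ y ≠ 0)
    (hsy : theta τ (s - y) ≠ 0) (hsx : theta τ (s - x) ≠ 0) :
    phi τ (z - w) (s - y) * phi τ z y * phi τ w x - phi τ (z - w) (s - x) * phi τ z x * phi τ w y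
      = phi τ z s * phi τ w t * (E1 τ (s - y) - E1 τ (s - x) + E1 τ y - E1 τ x) := by
  have hxs : theta τ (x - s) = -theta τ (s - x) := by rw [← theta_neg]; congr 1; ring
  have hxs0 : theta τ (x - s) ≠ 0 := by rw [hxs]; exact neg_ne_zero.2 hsx
  have hE := E1_add hτ (s - y) (x - s) y x (by ring) hsy hxs0 hy hx
  rw [show x - s = -(s - x) by ring, E1_neg hτ, theta_neg,
    show s - y + -(s - x) = x - y by ring, show -(s - x) + y = t by linear_combination -hst,
    show y + (s - y) = s by ring] at hE
  rw [show E1 τ (s - y) - E1 τ (s - x) + E1 τ y - E1 τ x =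
    E1 τ (s - y) + -E1 τ (s - x) + E1 τ y - E1 τ x by ring, hE]
  have h3 : theta τ (z - w + (s - y)) * theta τ (z + y) * theta τ (w + x) * theta τ (s - x)
      - theta τ (z - w + (s - x)) * theta τ (z + x) * theta τ (w + y) * theta τ (s - y)
      = -(theta τ (z + s) * theta τ (w + t) * theta τ (x - y) * theta τ (z - w)) := by
    have h := theta_three hτ ((z - w + s - y + (z + y)) / 2) ((z - w + s - y - (z + y)) / 2)
      ((w + x + (s - x)) / 2) ((w + x - (s - x)) / 2)
    obtain rfl : t = x + y - s := by linear_combination hst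
    rw [show (z - w + s - y + (z + y)) / 2 + (z - w + s - y - (z + y)) / 2 = z - w + (s - y) by ring,
      show (z - w + s - y + (z + y)) / 2 - (z - w + s - y - (z + y)) / 2 = z + y by ring,
      show (w + x + (s - x)) / 2 + (w + x - (s - x)) / 2 = w + x by ring,
      show (w + x + (s - x)) / 2 - (w + x - (s - x)) / 2 = s - x by ring,
      show (z - w + s - y + (z + y)) / 2 + (w + x + (s - x)) / 2 = z + s by ring,
      show (z - w + s - y + (z + y)) / 2 - (w + x + (s - x)) / 2 = z - w by ring,
      show (z - w + s - y - (z + y)) / 2 + (w + x - (s - x)) / 2 = x - y by ring,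
      show (z - w + s - y - (z + y)) / 2 - (w + x - (s - x)) / 2 = -(w + (x + y - s)) by ring,
      show (z - w + s - y + (z + y)) / 2 + (w + x - (s - x)) / 2 = z + x by ring,
      show (z - w + s - y + (z + y)) / 2 - (w + x - (s - x)) / 2 = z - w + (s - x) by ring,
      show (z - w + s - y - (z + y)) / 2 + (w + x + (s - x)) / 2 = s - y by ring,
      show (z - w + s - y - (z + y)) / 2 - (w + x + (s - x)) / 2 = -(w + y) by ring,
      theta_neg, theta_neg] at h
    linear_combination h
  unfold phi
  field_simp
  linear_combination deriv (theta τ) 0 ^ 3 * h3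

lemma phi_II {τ : ℂ} (hτ : 0 < τ.im) (z w s t : ℂ)
    (hz : theta τ z ≠ 0) (hw : theta τ w ≠ 0) (hzw : theta τ (z - w) ≠ 0)
    (hs : theta τ s ≠ 0) (ht : theta τ t ≠ 0) (hst : theta τ (s - t) ≠ 0)
    (hzs : theta τ (z + s) ≠ 0) (hwt : theta τ (w + t) ≠ 0) :
    phi τ (z - w) (s - t) * phi τ z t * phi τ w s
      = phi τ z s * phi τ w t * (E1 τ (z - w) + E1 τ (s - t) + E1 τ (w + t) - E1 τ (z + s)) := by
  rw [E1_add hτ (z - w) (s - t) (w + t) (z + s) (by ring) hzw hst hwt hzs,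
    show s - t + (w + t) = w + s by ring, show w + t + (z - w) = z + t by ring]
  unfold phi
  field_simp

/-! ### Summation lemmas -/

section sums
variable {N : ℕ}

lemma sum_swap_diag (P : Matrix (Fin N) (Fin N) ℂ)
    (hP : ∀ i, ∑ j, P i j = ∑ j, P j i) (g : Fin N → ℂ) :
    ∑ i, ∑ j, P i j * g i = ∑ i, ∑ j, P i j * g j := by
  rw [Finset.sum_comm (f := fun i j => P i j * g j)]
  refine Finset.sum_congr rfl fun i _ => ?_
  rw [← Finset.sum_mul, ← Finset.sum_mul, hP]

lemma quad_zero (P Q : Matrix (Fin N) (Fin N) ℂ)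
    (hP : ∀ i, ∑ j, P i j = ∑ j, P j i) (hQ : ∀ i, ∑ j, Q i j = ∑ j, Q j i)
    (e0 e1 e2 c1 c2 : Fin N → Fin N → ℂ) :
    ∑ i, ∑ j, ∑ k, ∑ l, P i j * Q k l *
      ((e0 i k - e0 j l) + (e1 j l - e1 i l) + (e2 j l - e2 j k)
        + ((if i = k then c1 i j else 0) - (if i = l then c1 i j else 0))
        + ((if j = k then c2 k l else 0) - (if i = k then c2 k l else 0))) = 0 := by
  have A : ∀ F : Fin N → Fin N → Fin N → ℂ,
      ∑ i, ∑ j, ∑ k, ∑ l, P i j * Q k l * (F i k l - F j k l) = 0 := by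
    intro F
    have : ∀ G : Fin N → ℂ, ∑ i, ∑ j, P i j * (G i - G j) = 0 := by
      intro G
      simp only [mul_sub, Finset.sum_sub_distrib]
      rw [sum_swap_diag P hP, sub_self]
    rw [← this (fun i => ∑ k, ∑ l, Q k l * F i k l)]
    refine Finset.sum_congr rfl fun i _ => Finset.sum_congr rfl fun j _ => ?_
    simp only [← Finset.sum_sub_distrib, Finset.mul_sum]
    refine Finset.sum_congr rfl fun k _ => Finset.sum_congr rfl fun l _ => ?_
    ring
  have B : ∀ F : Fin N → Fin N → Fin N → ℂ,
      ∑ i, ∑ j, ∑ k, ∑ l, P i j * Q k l * (F i j k - F i j l) = 0 := by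
    intro F
    refine Finset.sum_eq_zero fun i _ => Finset.sum_eq_zero fun j _ => ?_
    have := sum_swap_diag Q hQ (F i j)
    simp only [mul_assoc, ← Finset.mul_sum, mul_sub, Finset.sum_sub_distrib]
    rw [this, sub_self]
  have h1 := A (fun i k l => e0 i k - e1 i l - (if i = k then c2 k l else 0))
  have h2 := B (fun i j k => e0 j k - e2 j k + (if i = k then c1 i j else 0))
  refine Eq.trans ?_ ((congrArg₂ (· + ·) h1 h2).trans (add_zero 0))
  simp only [← Finset.sum_add_distrib]
  refine Finset.sum_congr rfl fun i _ => Finset.sum_congr rfl fun j _ =>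
    Finset.sum_congr rfl fun k _ => Finset.sum_congr rfl fun l _ => ?_
  ring

lemma r_zero (X Y L M r : Matrix (Fin N) (Fin N) ℂ) (hX : L * X = X * L) (hY : M * Y = Y * M) :
    ∑ i, ∑ j, ∑ k, ∑ l, X j i * Y l k * (r i k * L k j * M i l - r l j * L i l * M k j) = 0 := by
  have h1 : ∑ i, ∑ j, ∑ k, ∑ l, X j i * Y l k * (r i k * L k j * M i l) =
      ∑ i, ∑ k, r i k * (L * X) k i * (M * Y) i k := by
    refine Finset.sum_congr rfl fun i _ => ?_
    rw [Finset.sum_comm]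
    refine Finset.sum_congr rfl fun k _ => ?_
    simp only [Matrix.mul_apply, Finset.mul_sum, Finset.sum_mul]
    rw [Finset.sum_comm]
    refine Finset.sum_congr rfl fun l _ => Finset.sum_congr rfl fun j _ => ?_
    ring
  have h2 : ∑ i, ∑ j, ∑ k, ∑ l, X j i * Y l k * (r l j * L i l * M k j) =
      ∑ l, ∑ j, r l j * (X * L) j l * (Y * M) l j := by
    have e : ∀ i j, ∑ k, ∑ l, X j i * Y l k * (r l j * L i l * M k j) =
        ∑ l, ∑ k, X j i * Y l k * (r l j * L i l * M k j) := fun i j => Finset.sum_comm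
    simp only [e]
    rw [Finset.sum_comm]
    have e' : ∀ j, ∑ i, ∑ l, ∑ k, X j i * Y l k * (r l j * L i l * M k j) =
        ∑ l, ∑ i, ∑ k, X j i * Y l k * (r l j * L i l * M k j) := fun j => Finset.sum_comm
    simp only [e']
    rw [Finset.sum_comm]
    refine Finset.sum_congr rfl fun l _ => Finset.sum_congr rfl fun j _ => ?_
    simp only [Matrix.mul_apply, Finset.mul_sum, Finset.sum_mul]
    rw [Finset.sum_comm]
    refine Finset.sum_congr rfl fun i _ => Finset.sum_congr rfl fun k _ => ?_
    ring
  simp only [mul_sub, Finset.sum_sub_distrib]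
  rw [h1, h2, hX, hY, sub_self]

end sums

/-! ### Derivative of traces of powers -/

lemma trace_pow_deriv {N : ℕ} (F : ℂ → Matrix (Fin N) (Fin N) ℂ) (F' : Matrix (Fin N) (Fin N) ℂ)
    (t : ℂ) (h : ∀ i j, HasDerivAt (fun s => F s i j) (F' i j) t) (k : ℕ) :
    HasDerivAt (fun s => (F s ^ (k + 1)).trace) ((k + 1 : ℂ) * (F t ^ k * F').trace) t := by
  have key : ∀ k : ℕ, ∃ D : Matrix (Fin N) (Fin N) ℂ,
      (∀ i j, HasDerivAt (fun s => (F s ^ (k + 1)) i j) (D i j) t) ∧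
      ∀ Z, F t * Z = Z * F t → (D * Z).trace = (k + 1 : ℂ) * (F t ^ k * F' * Z).trace := by
    intro k
    induction k with
    | zero => exact ⟨F', by simpa using h, by simp⟩
    | succ k ih =>
      obtain ⟨D, hD, hZ⟩ := ih
      refine ⟨D * F t + F t ^ (k + 1) * F', fun i j => ?_, fun Z hc => ?_⟩
      · simp only [pow_succ _ (k + 1), Matrix.mul_apply, Matrix.add_apply, ← Finset.sum_add_distrib]
        refine HasDerivAt.fun_sum fun a _ => ?_
        exact (hD i a).mul (h a j)
      · have h1 := hZ (F t * Z) (by rw [mul_assoc, hc])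
        have h2 : (F t ^ k * F' * (F t * Z)).trace = (F t ^ (k + 1) * F' * Z).trace := by
          rw [hc, ← mul_assoc, Matrix.trace_mul_comm, pow_succ', mul_assoc, mul_assoc, mul_assoc]
        rw [add_mul, Matrix.trace_add, mul_assoc, h1, h2]
        push_cast
        ring
  obtain ⟨D, hD, hZ⟩ := key k
  have := hZ 1 (by simp)
  rw [mul_one, mul_one] at this
  rw [← this]
  exact HasDerivAt.fun_sum fun i _ => hD i i

/-! ### Logarithmic derivatives -/

def HLD (f : ℂ → ℂ) (l t : ℂ) : Prop := HasDerivAt f (f t * l) t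

lemma HLD.mul {f g : ℂ → ℂ} {l m t : ℂ} (hf : HLD f l t) (hg : HLD g m t) :
    HLD (fun s => f s * g s) (l + m) t := by
  have := HasDerivAt.fun_mul (c := f) (d := g) hf hg
  unfold HLD
  exact HasDerivAt.congr_deriv this (by ring)

lemma HLD.const (a t : ℂ) : HLD (fun _ => a) 0 t := by
  unfold HLD
  rw [mul_zero]
  exact hasDerivAt_const _ _

lemma HLD.div {f g : ℂ → ℂ} {l m t : ℂ} (hf : HLD f l t) (hg : HLD g m t) (h0 : g t ≠ 0) :
    HLD (fun s => f s / g s) (l - m) t := by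
  have := HasDerivAt.fun_div (c := f) (d := g) hf hg h0
  unfold HLD
  exact HasDerivAt.congr_deriv this (by field_simp)

lemma HLD.prod {ι : Type*} (S : Finset ι) {f : ι → ℂ → ℂ} {l : ι → ℂ} {t : ℂ}
    (hf : ∀ i ∈ S, HLD (f i) (l i) t) : HLD (fun s => ∏ i ∈ S, f i s) (∑ i ∈ S, l i) t := by
  classical
  induction S using Finset.induction_on with
  | empty => simpa using HLD.const 1 t
  | insert a S ha ih =>
    simp only [Finset.prod_insert ha, Finset.sum_insert ha]
    exact (hf a (Finset.mem_insert_self a S)).mul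
      (ih fun i hi => hf i (Finset.mem_insert_of_mem hi))

lemma HLD.theta {τ : ℂ} (hτ : 0 < τ.im) {u : ℂ → ℂ} {d t : ℂ} (hu : HasDerivAt u d t)
    (h0 : theta τ (u t) ≠ 0) : HLD (fun s => theta τ (u s)) (E1 τ (u t) * d) t := by
  have := HasDerivAt.comp (h₂ := _root_.theta τ) (h := u) t
    (theta_differentiable hτ (u t)).hasDerivAt hu
  unfold HLD E1
  exact HasDerivAt.congr_deriv this (by field_simp)

lemma HLD.phi {τ : ℂ} (hτ : 0 < τ.im) {u : ℂ → ℂ} {d t z : ℂ} (hu : HasDerivAt u d t)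
    (h0 : _root_.theta τ (u t) ≠ 0) (hz : _root_.theta τ z ≠ 0)
    (hzu : _root_.theta τ (z + u t) ≠ 0) :
    HLD (fun s => phi τ z (u s)) ((E1 τ (z + u t) - E1 τ (u t)) * d) t := by
  have h1 := (HLD.const (deriv (_root_.theta τ) 0) t).mul
    (HLD.theta hτ (u := fun s => z + u s) (hu.const_add z) hzu)
  have h2 := (HLD.const (_root_.theta τ z) t).mul (HLD.theta hτ hu h0)
  have h3 := h1.div h2 (mul_ne_zero hz h0)
  unfold _root_.phi
  refine HasDerivAt.congr_deriv h3 ?_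
  ring

lemma upd_deriv {N : ℕ} (q : Fin N → ℂ) (a i : Fin N) :
    HasDerivAt (fun t => Function.update q a t i) (if i = a then (1 : ℂ) else 0) (q a) := by
  by_cases h : i = a
  · subst h
    simp
    exact hasDerivAt_id' (q i)
  · simpa [h] using hasDerivAt_const (q a) (q i)

/-- logarithmic derivative of `b_j` in `q_a` -/
def bet (τ η : ℂ) {N : ℕ} (q : Fin N → ℂ) (j a : Fin N) : ℂ :=
  ∑ k ∈ Finset.univ.filter (fun k => k ≠ j), (E1 τ (q j - q k - η) - E1 τ (q j - q k)) *
    ((if j = a then (1 : ℂ) else 0) - (if k = a then (1 : ℂ) else 0))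

lemma bet_ne (τ η : ℂ) {N : ℕ} (q : Fin N → ℂ) (j a : Fin N) (h : j ≠ a) :
    bet τ η q j a = E1 τ (q j - q a) - E1 τ (q j - q a - η) := by
  unfold bet
  rw [Finset.sum_eq_single a]
  · simp [h]
  · intro b _ hb
    simp [h, hb]
  · intro h'
    simp [h.symm] at h'

/-- logarithmic derivative of `phi` -/
def chi (τ η z : ℂ) {N : ℕ} (q : Fin N → ℂ) (i j : Fin N) : ℂ :=
  E1 τ (z + (q i - q j + η)) - E1 τ (q i - q j + η)

lemma Lax_q {τ : ℂ} (hτ : 0 < τ.im) (η c z : ℂ) {N : ℕ} (x : Phase N)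
    (hz : theta τ z ≠ 0)
    (hq : ∀ i j : Fin N, i ≠ j → theta τ (x.2 i - x.2 j) ≠ 0)
    (hqp : ∀ i j : Fin N, theta τ (x.2 i - x.2 j + η) ≠ 0)
    (hqm : ∀ i j : Fin N, i ≠ j → theta τ (x.2 i - x.2 j - η) ≠ 0)
    (hzq : ∀ i j : Fin N, theta τ (z + (x.2 i - x.2 j + η)) ≠ 0) (a i j : Fin N) :
    HasDerivAt (fun t => Lax τ η c z (x.1, Function.update x.2 a t) i j)
      (Lax τ η c z x i j * (chi τ η z x.2 i j *
        ((if i = a then (1 : ℂ) else 0) - (if j = a then (1 : ℂ) else 0)) + bet τ η x.2 j a))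
      (x.2 a) := by
  have hu : ∀ i j, HasDerivAt (fun t => Function.update x.2 a t i - Function.update x.2 a t j)
      ((if i = a then (1 : ℂ) else 0) - (if j = a then (1 : ℂ) else 0)) (x.2 a) :=
    fun i j => (upd_deriv x.2 a i).fun_sub (upd_deriv x.2 a j)
  have h1 := HLD.phi (z := z) hτ ((hu i j).add_const η) (by simpa using hqp i j) hz
    (by simpa using hzq i j)
  have h2 : HLD (fun t => ∏ k ∈ Finset.univ.filter (fun k => k ≠ j),
      theta τ (Function.update x.2 a t j - Function.update x.2 a t k - η) /
        theta τ (Function.update x.2 a t j - Function.update x.2 a t k))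
      (bet τ η x.2 j a) (x.2 a) := by
    refine HLD.prod _ fun k hk => ?_
    have hk' : j ≠ k := by simpa [eq_comm] using hk
    have := (HLD.theta hτ ((hu j k).sub_const η) (by simpa using hqm j k hk')).div
      (HLD.theta hτ (hu j k) (by simpa using hq j k hk')) (by simpa using hq j k hk')
    simp only [Function.update_eq_self] at this
    rw [sub_mul]
    exact this
  have h3 := h1.mul ((HLD.const (cexp (x.1 j / c)) _).mul h2)
  unfold HLD at h3
  simp only [Function.update_eq_self, zero_add] at h3
  exact h3

lemma Lax_p (τ η c z : ℂ) {N : ℕ} (x : Phase N) (a i j : Fin N) :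
    HasDerivAt (fun t => Lax τ η c z (Function.update x.1 a t, x.2) i j)
      (Lax τ η c z x i j * ((if j = a then (1 : ℂ) else 0) / c)) (x.1 a) := by
  have h := (((upd_deriv x.1 a j).div_const c).cexp.mul_const (∏ k ∈ Finset.univ.filter
    (fun k => k ≠ j), theta τ (x.2 j - x.2 k - η) / theta τ (x.2 j - x.2 k))).const_mul
      (phi τ z (x.2 i - x.2 j + η))
  simp only [Function.update_eq_self] at h
  refine HasDerivAt.congr_deriv h ?_
  simp only [Lax, bfun, Matrix.of_apply]
  ring

/-! ### Assembly -/

lemma half_sum {N : ℕ} (c : ℂ) (P : Matrix (Fin N) (Fin N) ℂ) (G : Fin N → ℂ) :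
    ∑ a, (∑ i, ∑ j, P i j * ((if j = a then (1 : ℂ) else 0) / c)) * G a =
      c⁻¹ * ∑ i, ∑ j, P i j * G j := by
  simp only [Finset.sum_mul, Finset.mul_sum]
  rw [Finset.sum_comm]
  refine Finset.sum_congr rfl fun i _ => ?_
  rw [Finset.sum_comm]
  refine Finset.sum_congr rfl fun j _ => ?_
  rw [Finset.sum_eq_single j]
  · simp; ring
  · intro b _ hb
    simp [hb.symm]
  · simp

lemma full_sum {N : ℕ} (c : ℂ) (P Q : Matrix (Fin N) (Fin N) ℂ)
    (lz lw : Fin N → Fin N → Fin N → ℂ) :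
    ∑ a, ((∑ i, ∑ j, P i j * ((if j = a then (1 : ℂ) else 0) / c)) *
        (∑ k, ∑ l, Q k l * lw k l a) -
      (∑ i, ∑ j, P i j * lz i j a) *
        (∑ k, ∑ l, Q k l * ((if l = a then (1 : ℂ) else 0) / c))) =
      c⁻¹ * ∑ i, ∑ j, ∑ k, ∑ l, P i j * Q k l * (lw k l j - lz i j l) := by
  rw [Finset.sum_sub_distrib, half_sum]
  simp only [mul_comm (∑ i, ∑ j, P i j * lz i j _)]
  rw [half_sum, ← mul_sub]
  congr 1
  have e : ∑ k, ∑ l, Q k l * ∑ i, ∑ j, P i j * lz i j l =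
      ∑ i, ∑ j, ∑ k, ∑ l, P i j * Q k l * lz i j l := by
    simp only [Finset.mul_sum]
    have e1 : ∀ k, ∑ l, ∑ i, ∑ j, Q k l * (P i j * lz i j l) =
        ∑ i, ∑ j, ∑ l, Q k l * (P i j * lz i j l) := by
      intro k
      rw [Finset.sum_comm]
      exact Finset.sum_congr rfl fun i _ => Finset.sum_comm
    simp only [e1]
    rw [Finset.sum_comm]
    refine Finset.sum_congr rfl fun i _ => ?_
    rw [Finset.sum_comm]
    refine Finset.sum_congr rfl fun j _ => Finset.sum_congr rfl fun k _ =>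
      Finset.sum_congr rfl fun l _ => ?_
    ring
  rw [e]
  simp only [Finset.mul_sum, ← Finset.sum_sub_distrib]
  refine Finset.sum_congr rfl fun i _ => Finset.sum_congr rfl fun j _ =>
    Finset.sum_congr rfl fun k _ => Finset.sum_congr rfl fun l _ => ?_
  ring

/-- The coefficient produced by the commutator with the r-matrix. -/
def Wc {N : ℕ} (e0 ep cz cw : Fin N → Fin N → ℂ) (i j k l : Fin N) : ℂ :=
  e0 i k + e0 j l + ep k j - ep i l + (if i = k then cz i j - cw k l else 0)
    + (if j = l then cw k l - cz i j else 0)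

lemma U_add_W {N : ℕ} (e0 ep cz cw be : Fin N → Fin N → ℂ) (he0 : ∀ i j, e0 i j = -e0 j i)
    (hbe : ∀ i j, i ≠ j → be i j = e0 i j + ep j i) (i j k l : Fin N) :
    (cw k l * ((if k = j then (1 : ℂ) else 0) - (if l = j then (1 : ℂ) else 0)) + be l j)
      - (cz i j * ((if i = l then (1 : ℂ) else 0) - (if j = l then (1 : ℂ) else 0)) + be j l)
      + Wc e0 ep cz cw i j k l =
    ((e0 i k - e0 j l) + (ep j l - ep i l) + (-ep l j - -ep k j)
        + ((if i = k then cz i j else 0) - (if i = l then cz i j else 0))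
        + ((if j = k then cw k l else 0) - (if i = k then cw k l else 0))) := by
  unfold Wc
  have e1 : (if k = j then (1 : ℂ) else 0) = if j = k then 1 else 0 := by simp only [eq_comm]
  have e2 : (if l = j then (1 : ℂ) else 0) = if j = l then 1 else 0 := by simp only [eq_comm]
  rw [e1, e2]
  by_cases hjl : j = l
  · subst hjl
    have h0 : e0 j j = 0 := by linear_combination he0 j j / 2
    rw [h0]
    split_ifs <;> simp <;> ring
  · rw [hbe j l hjl, hbe l j (Ne.symm hjl), he0 l j]
    split_ifs <;> simp <;> ring

lemma r_comm {τ : ℂ} (hτ : 0 < τ.im) (η c z w : ℂ) {N : ℕ} (x : Phase N)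
    (hz : theta τ z ≠ 0) (hw : theta τ w ≠ 0) (hzw : theta τ (z - w) ≠ 0)
    (hq : ∀ i j : Fin N, i ≠ j → theta τ (x.2 i - x.2 j) ≠ 0)
    (hqp : ∀ i j : Fin N, theta τ (x.2 i - x.2 j + η) ≠ 0)
    (hzq : ∀ i j : Fin N, theta τ (z + (x.2 i - x.2 j + η)) ≠ 0)
    (hwq : ∀ i j : Fin N, theta τ (w + (x.2 i - x.2 j + η)) ≠ 0) (i j k l : Fin N) :
    (if i = k then E1 τ (z - w) else phi τ (z - w) (x.2 i - x.2 k)) *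
        Lax τ η c z x k j * Lax τ η c w x i l
      - (if l = j then E1 τ (z - w) else phi τ (z - w) (x.2 l - x.2 j)) *
        Lax τ η c z x i l * Lax τ η c w x k j =
    Lax τ η c z x i j * Lax τ η c w x k l *
      Wc (fun i j => if i = j then 0 else E1 τ (x.2 i - x.2 j))
        (fun i j => E1 τ (x.2 i - x.2 j + η)) (chi τ η z x.2) (chi τ η w x.2) i j k l := by
  simp only [Lax, Matrix.of_apply, Wc]
  generalize bfun τ η c j x = bj
  generalize bfun τ η c l x = bl
  have hneg : ∀ a b : Fin N, E1 τ (x.2 a - x.2 b) = -E1 τ (x.2 b - x.2 a) := by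
    intro a b
    rw [← E1_neg hτ, neg_sub]
  by_cases hik : i = k
  · subst hik
    by_cases hjl : j = l
    · subst hjl
      simp
      ring
    · have h := phi_II hτ z w (x.2 i - x.2 j + η) (x.2 i - x.2 l + η) hz hw hzw (hqp _ _) (hqp _ _)
        (by rw [show x.2 i - x.2 j + η - (x.2 i - x.2 l + η) = x.2 l - x.2 j by ring]
            exact hq _ _ (Ne.symm hjl)) (hzq _ _) (hwq _ _)
      rw [show x.2 i - x.2 j + η - (x.2 i - x.2 l + η) = x.2 l - x.2 j by ring, hneg l j] at h
      simp only [if_true, hjl, Ne.symm hjl, if_false, chi]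
      linear_combination -bj * bl * h
  · by_cases hjl : j = l
    · subst hjl
      have h := phi_II hτ z w (x.2 i - x.2 j + η) (x.2 k - x.2 j + η) hz hw hzw (hqp _ _) (hqp _ _)
        (by rw [show x.2 i - x.2 j + η - (x.2 k - x.2 j + η) = x.2 i - x.2 k by ring]
            exact hq _ _ hik) (hzq _ _) (hwq _ _)
      rw [show x.2 i - x.2 j + η - (x.2 k - x.2 j + η) = x.2 i - x.2 k by ring] at h
      simp only [if_true, hik, if_false, chi]
      linear_combination bj * bl * h
    · have h := phi_I hτ z w (x.2 i - x.2 j + η) (x.2 k - x.2 l + η) (x.2 i - x.2 l + η)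
        (x.2 k - x.2 j + η) (by ring) hz hw hzw (hqp _ _) (hqp _ _) (hqp _ _) (hqp _ _)
        (by rw [show x.2 i - x.2 j + η - (x.2 k - x.2 j + η) = x.2 i - x.2 k by ring]
            exact hq _ _ hik)
        (by rw [show x.2 i - x.2 j + η - (x.2 i - x.2 l + η) = x.2 l - x.2 j by ring]
            exact hq _ _ (Ne.symm hjl))
      rw [show x.2 i - x.2 j + η - (x.2 k - x.2 j + η) = x.2 i - x.2 k by ring,
        show x.2 i - x.2 j + η - (x.2 i - x.2 l + η) = x.2 l - x.2 j by ring, hneg l j] at h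
      simp only [hik, hjl, Ne.symm hjl, if_false]
      linear_combination bj * bl * h

lemma Lax_trace_comm {τ : ℂ} (hτ : 0 < τ.im) (η c z w : ℂ) {N : ℕ} (x : Phase N)
    (hz : theta τ z ≠ 0) (hw : theta τ w ≠ 0) (hzw : theta τ (z - w) ≠ 0)
    (hq : ∀ i j : Fin N, i ≠ j → theta τ (x.2 i - x.2 j) ≠ 0)
    (hqp : ∀ i j : Fin N, theta τ (x.2 i - x.2 j + η) ≠ 0)
    (hqm : ∀ i j : Fin N, i ≠ j → theta τ (x.2 i - x.2 j - η) ≠ 0)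
    (hzq : ∀ i j : Fin N, theta τ (z + (x.2 i - x.2 j + η)) ≠ 0)
    (hwq : ∀ i j : Fin N, theta τ (w + (x.2 i - x.2 j + η)) ≠ 0) (k m : ℕ) :
    pbracket (fun y => ((Lax τ η c z y) ^ (k + 1)).trace)
      (fun y => ((Lax τ η c w y) ^ (m + 1)).trace) x = 0 := by
  set L := Lax τ η c z x with hL
  set M := Lax τ η c w x with hM
  set X := L ^ k with hX
  set Y := M ^ m with hY
  set P : Matrix (Fin N) (Fin N) ℂ := Matrix.of fun i j => X j i * L i j with hP
  set Q : Matrix (Fin N) (Fin N) ℂ := Matrix.of fun i j => Y j i * M i j with hQ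
  have tr : ∀ (A B l : Matrix (Fin N) (Fin N) ℂ),
      (A * Matrix.of fun i j => B i j * l i j).trace =
        ∑ i, ∑ j, (Matrix.of fun i j => A j i * B i j) i j * l i j := by
    intro A B l
    simp only [Matrix.trace, Matrix.diag_apply, Matrix.mul_apply, Matrix.of_apply]
    rw [Finset.sum_comm]
    refine Finset.sum_congr rfl fun i _ => Finset.sum_congr rfl fun j _ => ?_
    ring
  have dq : ∀ (z : ℂ) (_ : theta τ z ≠ 0)
      (_ : ∀ i j : Fin N, theta τ (z + (x.2 i - x.2 j + η)) ≠ 0) (k : ℕ) (a : Fin N),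
      deriv (fun t => ((Lax τ η c z (x.1, Function.update x.2 a t)) ^ (k + 1)).trace) (x.2 a) =
      (k + 1 : ℂ) * ∑ i, ∑ j, (Matrix.of fun i j => (Lax τ η c z x ^ k) j i * Lax τ η c z x i j) i j *
        (chi τ η z x.2 i j *
        ((if i = a then (1 : ℂ) else 0) - (if j = a then (1 : ℂ) else 0)) + bet τ η x.2 j a) := by
    intro z hz hzq k a
    have := (trace_pow_deriv (fun t => Lax τ η c z (x.1, Function.update x.2 a t))
      (Matrix.of fun i j => Lax τ η c z x i j * (chi τ η z x.2 i j *
        ((if i = a then (1 : ℂ) else 0) - (if j = a then (1 : ℂ) else 0)) + bet τ η x.2 j a))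
      (x.2 a) (fun i j => Lax_q hτ η c z x hz hq hqp hqm hzq a i j) k).deriv
    rw [this]
    simp only [Function.update_eq_self]
    rw [tr _ _ (fun i j => (chi τ η z x.2 i j *
        ((if i = a then (1 : ℂ) else 0) - (if j = a then (1 : ℂ) else 0)) + bet τ η x.2 j a))]
  have dp : ∀ (z : ℂ) (k : ℕ) (a : Fin N),
      deriv (fun t => ((Lax τ η c z (Function.update x.1 a t, x.2)) ^ (k + 1)).trace) (x.1 a) =
      (k + 1 : ℂ) * ∑ i, ∑ j, (Matrix.of fun i j => (Lax τ η c z x ^ k) j i * Lax τ η c z x i j) i j *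
        ((if j = a then (1 : ℂ) else 0) / c) := by
    intro z k a
    have := (trace_pow_deriv (fun t => Lax τ η c z (Function.update x.1 a t, x.2))
      (Matrix.of fun i j => Lax τ η c z x i j * ((if j = a then (1 : ℂ) else 0) / c))
      (x.1 a) (fun i j => Lax_p τ η c z x a i j) k).deriv
    rw [this]
    simp only [Function.update_eq_self]
    rw [tr _ _ (fun i j => ((if j = a then (1 : ℂ) else 0) / c))]
  have main : ∑ i, ∑ j, ∑ k, ∑ l, P i j * Q k l *
      ((chi τ η w x.2 k l * ((if k = j then (1 : ℂ) else 0) - (if l = j then (1 : ℂ) else 0))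
          + bet τ η x.2 l j) -
       (chi τ η z x.2 i j * ((if i = l then (1 : ℂ) else 0) - (if j = l then (1 : ℂ) else 0))
          + bet τ η x.2 j l)) = 0 := by
    have cL : L * X = X * L := by rw [hX, ← pow_succ, ← pow_succ']
    have cM : M * Y = Y * M := by rw [hY, ← pow_succ, ← pow_succ']
    have rowcol : ∀ A B : Matrix (Fin N) (Fin N) ℂ, B * A = A * B → ∀ i,
        ∑ j, (Matrix.of fun i j => A j i * B i j) i j =
        ∑ j, (Matrix.of fun i j => A j i * B i j) j i := by
      intro A B h i
      have := congrFun (congrFun h i) i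
      simp only [Matrix.mul_apply] at this
      simp only [Matrix.of_apply, ← this]
      exact Finset.sum_congr rfl fun j _ => mul_comm _ _
    have q0 := quad_zero P Q (rowcol X L cL) (rowcol Y M cM)
      (fun i j => if i = j then 0 else E1 τ (x.2 i - x.2 j))
      (fun i j => E1 τ (x.2 i - x.2 j + η)) (fun i j => -E1 τ (x.2 j - x.2 i + η))
      (chi τ η z x.2) (chi τ η w x.2)
    have r0 := r_zero X Y L M (Matrix.of fun i k => if i = k then E1 τ (z - w) else
      phi τ (z - w) (x.2 i - x.2 k)) cL cM
    refine Eq.trans ?_ ((congrArg₂ (· - ·) q0 r0).trans (sub_zero 0))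
    simp only [← Finset.sum_sub_distrib]
    refine Finset.sum_congr rfl fun i _ => Finset.sum_congr rfl fun j _ =>
      Finset.sum_congr rfl fun k _ => Finset.sum_congr rfl fun l _ => ?_
    have hU := U_add_W (fun i j => if i = j then 0 else E1 τ (x.2 i - x.2 j))
      (fun i j => E1 τ (x.2 i - x.2 j + η)) (chi τ η z x.2) (chi τ η w x.2) (bet τ η x.2)
      (by
        intro i j
        by_cases h : i = j
        · simp [h]
        · simp only [h, Ne.symm h, if_false]
          rw [← E1_neg hτ, neg_sub])
      (by
        intro i j h
        rw [bet_ne _ _ _ _ _ h]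
        simp only [h, if_false]
        rw [show x.2 i - x.2 j - η = -(x.2 j - x.2 i + η) by ring, E1_neg hτ, sub_neg_eq_add])
      i j k l
    have hr := r_comm hτ η c z w x hz hw hzw hq hqp hzq hwq i j k l
    rw [← hL, ← hM] at hr
    rw [← hU]
    simp only [Matrix.of_apply]
    rw [hr]
    simp only [hP, hQ, Matrix.of_apply]
    ring
  have fs := full_sum c P Q
    (fun i j a => chi τ η z x.2 i j *
        ((if i = a then (1 : ℂ) else 0) - (if j = a then (1 : ℂ) else 0)) + bet τ η x.2 j a)
    (fun i j a => chi τ η w x.2 i j *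
        ((if i = a then (1 : ℂ) else 0) - (if j = a then (1 : ℂ) else 0)) + bet τ η x.2 j a)
  rw [main, mul_zero] at fs
  unfold pbracket
  simp only [dq z hz hzq, dq w hw hwq, dp]
  refine Eq.trans ?_ ((congrArg (fun y => ((k + 1 : ℂ) * (m + 1 : ℂ)) * y) fs).trans (mul_zero _))
  rw [Finset.mul_sum]
  refine Finset.sum_congr rfl fun a _ => ?_
  simp only [hP, hQ, hX, hY, hL, hM, Matrix.of_apply]
  ring

lemma theta_nonzero_or (τ : ℂ) : (∃ z, theta τ z ≠ 0) ∨ ∀ z, theta τ z = 0 := by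
  by_cases h : ∃ z, theta τ z ≠ 0
  · exact Or.inl h
  · right; push Not at h; exact h

/-- Liouville involutivity for the Ruijsenaars–Schneider model: for all
k, m ≥ 1 and generic spectral parameters z, w, {tr(L(z)^k), tr(L(w)^m)} = 0. -/
theorem rs_traces_in_involution {N : ℕ} (τ η c : ℂ) (hτ : 0 < τ.im) (hc : c ≠ 0)
    (z w : ℂ) (x : Phase N) (k m : ℕ) (hk : 1 ≤ k) (hm : 1 ≤ m)
    (hz : z ∉ Lam τ) (hw : w ∉ Lam τ) (hzw : z - w ∉ Lam τ) (hη : η ∉ Lam τ)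
    (hq : ∀ i j : Fin N, i ≠ j → x.2 i - x.2 j ∉ Lam τ)
    (hqpη : ∀ i j : Fin N, x.2 i - x.2 j + η ∉ Lam τ)
    (hqmη : ∀ i j : Fin N, i ≠ j → x.2 i - x.2 j - η ∉ Lam τ)
    (hzq : ∀ i j : Fin N, z + (x.2 i - x.2 j) + η ∉ Lam τ)
    (hwq : ∀ i j : Fin N, w + (x.2 i - x.2 j) + η ∉ Lam τ) :
    pbracket (fun y => ((Lax τ η c z y) ^ k).trace)
      (fun y => ((Lax τ η c w y) ^ m).trace) x = 0 := by
  obtain ⟨k, rfl⟩ := Nat.exists_eq_add_of_le' hk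
  obtain ⟨m, rfl⟩ := Nat.exists_eq_add_of_le' hm
  rcases theta_nonzero_or τ with h0 | h0
  · have ne : ∀ {e : ℂ}, e ∉ Lam τ → theta τ e ≠ 0 := fun he => theta_ne_zero hτ h0 he
    exact Lax_trace_comm hτ η c z w x (ne hz) (ne hw) (ne hzw) (fun i j h => ne (hq i j h))
      (fun i j => ne (hqpη i j)) (fun i j h => ne (hqmη i j h))
      (fun i j => by rw [← add_assoc]; exact ne (hzq i j))
      (fun i j => by rw [← add_assoc]; exact ne (hwq i j)) k m
  · have hL : ∀ z (y : Phase N), Lax τ η c z y = 0 := by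
      intro z y
      ext i j
      simp [Lax, phi, h0]
    simp [pbracket, hL]

end
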